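/- There exist constants C > 0 and L₀ > 2 such that for every L > L₀ and every measurable set E ⊆ S with |E| = 4πL that is centered around the origin, one has |∫_E ∫_E K(z,ξ) dz dξ − ∫_{E₀} ∫_{E₀} K(z,ξ) dz dξ| ≤ C · ∫_{E Δ E₀} ||x|−L| dz, where E₀ = [−L,L] × 𝕋 and E Δ E₀ is the symmetric difference. -/

import Mathlib

open MeasureTheory Real

noncomputable section

instance : Fact (0 < 2 * π) := ⟨by positivity⟩

/-- The circle `𝕋 = ℝ/(2πℤ)` of circumference `2π`, carrying its Haar measure of mass `2π`. -/
abbrev Torus : Type := AddCircle (2 * π)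

/-- The infinite strip `S = ℝ × 𝕋` with the product of Lebesgue and Haar measure. -/
abbrev Strip : Type := ℝ × Torus

/-- `cos`, well-defined on `𝕋 = ℝ/(2πℤ)`. -/
def cosT : Torus → ℝ := Real.cos_periodic.lift

/-- `sin`, well-defined on `𝕋 = ℝ/(2πℤ)`. -/
def sinT : Torus → ℝ := Real.sin_periodic.lift

/-- The kernel `K(z,ξ) = log(cosh(x₁-x₂) - cos(y₁-y₂)) - |x₁-x₂| + log 2` on `S × S`. -/
def Kker (z ξ : Strip) : ℝ :=
  Real.log (Real.cosh (z.1 - ξ.1) - cosT (z.2 - ξ.2)) - |z.1 - ξ.1| + Real.log 2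

open scoped ENNReal NNReal

/-- The kernel `Kker` as a function of the two coordinate differences. -/
def stripProfile (x : ℝ) (t : Torus) : ℝ :=
  Real.log (Real.cosh x - cosT t) - |x| + Real.log 2

lemma Kker_eq_stripProfile (z ξ : Strip) :
    Kker z ξ = stripProfile (z.1 - ξ.1) (z.2 - ξ.2) := rfl

lemma cosT_coe (s : ℝ) : cosT (s : Torus) = Real.cos s := rfl

lemma continuous_cosT : Continuous cosT :=
  continuous_coinduced_dom.mpr Real.continuous_cos

lemma cosT_neg (t : Torus) : cosT (-t) = cosT t := by
  induction t using QuotientAddGroup.induction_on with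
  | H s => exact Real.cos_neg s

lemma abs_cosT_le_one (t : Torus) : |cosT t| ≤ 1 := by
  induction t using QuotientAddGroup.induction_on with
  | H s => exact Real.abs_cos_le_one s

lemma measurable_Kker : Measurable fun p : Strip × Strip => Kker p.1 p.2 := by
  have := continuous_cosT.measurable
  unfold Kker
  fun_prop

lemma Kker_comm (z ξ : Strip) : Kker z ξ = Kker ξ z := by
  unfold Kker
  rw [← neg_sub ξ.1 z.1, ← neg_sub ξ.2 z.2, Real.cosh_neg, cosT_neg, abs_neg]

lemma log_cosh_sub_sub_abs_add_log_two {x c : ℝ} (h : 0 < Real.cosh x - c) :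
    Real.log (Real.cosh x - c) - |x| + Real.log 2 =
      Real.log (1 - 2 * Real.exp (-|x|) * c + Real.exp (-|x|) ^ 2) := by
  have hr : Real.log (Real.exp (-|x|)) = -|x| := Real.log_exp _
  have he : Real.exp |x| * Real.exp (-|x|) = 1 := by rw [← Real.exp_add]; simp
  have h1 : 1 - 2 * Real.exp (-|x|) * c + Real.exp (-|x|) ^ 2 =
      (Real.cosh x - c) * Real.exp (-|x|) * 2 := by
    rw [← Real.cosh_abs, Real.cosh_eq]
    linear_combination -he
  rw [h1, Real.log_mul (by positivity) (by norm_num), Real.log_mul h.ne' (by positivity), hr]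
  ring

lemma abs_stripProfile_coe_le (x : ℝ) {s : ℝ} (hs : Real.sin s ≠ 0) :
    |stripProfile x (s : Torus)| ≤ Real.log 4 + 2 * |Real.log (Real.sin s)| := by
  have hsq := Real.sin_sq_add_cos_sq s
  have hpos : 0 < Real.sin s ^ 2 := by positivity
  have hc : Real.cos s < 1 := by nlinarith
  have hc' : -1 ≤ Real.cos s := Real.neg_one_le_cos s
  have hch := Real.one_le_cosh x
  rw [stripProfile, cosT_coe, log_cosh_sub_sub_abs_add_log_two (by linarith)]
  have hr0 := Real.exp_pos (-|x|)
  have hr1 : Real.exp (-|x|) ≤ 1 := Real.exp_le_one_iff.mpr (by simp)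
  set r := Real.exp (-|x|)
  have hlow : Real.sin s ^ 2 ≤ 1 - 2 * r * Real.cos s + r ^ 2 := by
    nlinarith [sq_nonneg (r - Real.cos s)]
  have hup : 1 - 2 * r * Real.cos s + r ^ 2 ≤ 4 := by nlinarith
  have h1 := Real.log_le_log hpos hlow
  have h2 := Real.log_le_log (hpos.trans_le hlow) hup
  rw [Real.log_pow] at h1
  push_cast at h1
  have h4 : 0 ≤ Real.log 4 := Real.log_nonneg (by norm_num)
  rw [abs_le]
  constructor <;> linarith [neg_abs_le (Real.log (Real.sin s)), abs_nonneg (Real.log (Real.sin s))]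

lemma abs_stripProfile_le_of_one_le {x : ℝ} (hx : 1 ≤ |x|) (t : Torus) :
    |stripProfile x t| ≤ Real.log 4 := by
  have hc := abs_le.mp (abs_cosT_le_one t)
  have hch : 1 < Real.cosh x := Real.one_lt_cosh.mpr (by rintro rfl; norm_num at hx)
  rw [stripProfile, log_cosh_sub_sub_abs_add_log_two (by linarith)]
  have hr0 := Real.exp_pos (-|x|)
  have hr1 : Real.exp (-|x|) ≤ 1 / 2 := by
    have h1 : Real.exp (-|x|) ≤ Real.exp (-1) := Real.exp_le_exp.mpr (by linarith)
    have h2 := Real.exp_neg_one_lt_d9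
    linarith
  set r := Real.exp (-|x|)
  have hlow : 4⁻¹ ≤ 1 - 2 * r * cosT t + r ^ 2 := by nlinarith
  have hup : 1 - 2 * r * cosT t + r ^ 2 ≤ 4 := by nlinarith
  have h1 := Real.log_le_log (by norm_num) hlow
  rw [Real.log_inv] at h1
  exact abs_le.mpr ⟨h1, Real.log_le_log (by linarith) hup⟩

lemma ae_sin_ne_zero : ∀ᵐ s : ℝ, Real.sin s ≠ 0 := by
  have : {s : ℝ | Real.sin s = 0}.Countable := by
    refine (Set.countable_range fun n : ℤ => (n : ℝ) * π).mono fun s hs => ?_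
    obtain ⟨n, hn⟩ := Real.sin_eq_zero_iff.mp hs
    exact ⟨n, hn⟩
  rw [ae_iff]
  simpa using this.measure_zero volume

/-- The `L¹` norm of the kernel over a circle is bounded uniformly in the axial difference. -/
lemma exists_lintegral_enorm_stripProfile_le :
    ∃ M : ℝ≥0, ∀ x : ℝ, ∫⁻ t : Torus, ‖stripProfile x t‖ₑ ≤ M := by
  have hint : IntervalIntegrable (fun s => Real.log 4 + 2 * |Real.log (Real.sin s)|) volume
      0 (2 * π) :=
    intervalIntegrable_const.add (intervalIntegrable_log_sin.abs.const_mul 2)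
  rw [intervalIntegrable_iff_integrableOn_Ioc_of_le (by positivity)] at hint
  refine ⟨(∫⁻ s in Set.Ioc 0 (2 * π), ‖Real.log 4 + 2 * |Real.log (Real.sin s)|‖ₑ).toNNReal,
    fun x => ?_⟩
  rw [ENNReal.coe_toNNReal hint.2.ne, ← AddCircle.lintegral_preimage (2 * π) 0, zero_add]
  refine lintegral_mono_ae (ae_restrict_of_ae ?_)
  filter_upwards [ae_sin_ne_zero] with s hs
  rw [enorm_le_iff_norm_le]
  exact (abs_stripProfile_coe_le x hs).trans (le_abs_self _)

/-- The mean value of the kernel over a circle vanishes. -/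
lemma integral_stripProfile {x : ℝ} (hx : x ≠ 0) : ∫ t : Torus, stripProfile x t = 0 := by
  have hch : 1 < Real.cosh x := Real.one_lt_cosh.mpr hx
  have hr : Real.exp (-|x|) < 1 := by simpa using hx
  have h := circleAverage_log_norm_sub_const₀ (a := (Real.exp (-|x|) : ℂ)) (by
    rw [Complex.norm_real, Real.norm_of_nonneg]
    exacts [hr, (Real.exp_pos _).le])
  rw [circleAverage_def, smul_eq_zero_iff_right (by positivity)] at h
  rw [← AddCircle.intervalIntegral_preimage (2 * π) 0, zero_add]
  trans ∫ s in (0 : ℝ)..2 * π, 2 * Real.log ‖circleMap 0 1 s - Real.exp (-|x|)‖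
  · refine intervalIntegral.integral_congr fun s _ => ?_
    have hc := Real.cos_le_one s
    rw [stripProfile, cosT_coe, log_cosh_sub_sub_abs_add_log_two (by linarith)]
    rw [← Nat.cast_ofNat (n := 2) (R := ℝ), ← Real.log_pow, ← Complex.normSq_eq_norm_sq,
      circleMap_zero, Complex.ofReal_one, one_mul, Complex.exp_mul_I, Complex.normSq_apply]
    congr 1
    simp [← Complex.ofReal_cos, ← Complex.ofReal_sin, -Complex.ofReal_exp]
    linear_combination -(Real.sin_sq_add_cos_sq s)
  · rw [intervalIntegral.integral_const_mul, h, mul_zero]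

/-- Integral of the kernel over a union of circles. -/
lemma lintegral_enorm_Kker_prod_univ_le {M : ℝ≥0}
    (hM : ∀ x : ℝ, ∫⁻ t : Torus, ‖stripProfile x t‖ₑ ≤ M) (z : Strip) (T : Set ℝ) :
    ∫⁻ ξ in T ×ˢ (Set.univ : Set Torus), ‖Kker z ξ‖ₑ ≤ M * volume T := by
  have hmeas : Measurable fun ξ : Strip => ‖Kker z ξ‖ₑ :=
    (measurable_Kker.comp measurable_prodMk_left).enorm
  rw [Measure.volume_eq_prod, ← Measure.prod_restrict, Measure.restrict_univ,
    lintegral_prod _ hmeas.aemeasurable, ← setLIntegral_const]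
  refine lintegral_mono fun x => ?_
  simp only [Kker_eq_stripProfile]
  rw [lintegral_sub_left_eq_self fun t => ‖stripProfile (z.1 - x) t‖ₑ]
  exact hM _

lemma setLIntegral_enorm_Kker_le {M : ℝ≥0}
    (hM : ∀ x : ℝ, ∫⁻ t : Torus, ‖stripProfile x t‖ₑ ≤ M) (z : Strip) (A : Set Strip) :
    ∫⁻ ξ in A, ‖Kker z ξ‖ₑ ≤ ENNReal.ofReal (Real.log 4) * volume A + M * 2 := by
  set B : Set Strip := Set.Icc (z.1 - 1) (z.1 + 1) ×ˢ Set.univ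
  have hB : MeasurableSet B := measurableSet_Icc.prod .univ
  have hle : ∀ ξ, ‖Kker z ξ‖ₑ ≤
      ENNReal.ofReal (Real.log 4) + B.indicator (fun ξ => ‖Kker z ξ‖ₑ) ξ := by
    intro ξ
    by_cases hξ : ξ ∈ B
    · rw [Set.indicator_of_mem hξ]
      exact le_add_self
    · rw [Set.indicator_of_notMem hξ, add_zero, Real.enorm_eq_ofReal_abs]
      refine ENNReal.ofReal_le_ofReal (abs_stripProfile_le_of_one_le ?_ _)
      by_contra! h
      obtain ⟨h1, h2⟩ := abs_lt.mp h
      exact hξ ⟨⟨by linarith, by linarith⟩, trivial⟩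
  calc ∫⁻ ξ in A, ‖Kker z ξ‖ₑ
      ≤ ∫⁻ ξ in A, (ENNReal.ofReal (Real.log 4) + B.indicator (fun ξ => ‖Kker z ξ‖ₑ) ξ) :=
        lintegral_mono hle
    _ = ENNReal.ofReal (Real.log 4) * volume A +
          ∫⁻ ξ in A, B.indicator (fun ξ => ‖Kker z ξ‖ₑ) ξ := by
        rw [lintegral_add_left measurable_const, setLIntegral_const]
    _ ≤ ENNReal.ofReal (Real.log 4) * volume A + ∫⁻ ξ in B, ‖Kker z ξ‖ₑ := by
        exact add_le_add_right
          ((setLIntegral_le_lintegral _ _).trans (lintegral_indicator hB _).le) _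
    _ ≤ _ := by
        gcongr
        refine (lintegral_enorm_Kker_prod_univ_le hM z _).trans_eq ?_
        rw [Real.volume_Icc, show z.1 + 1 - (z.1 - 1) = 2 by ring, ENNReal.ofReal_ofNat]

lemma integrable_Kker_prod {A B : Set Strip} (hA : volume A ≠ ∞) (hB : volume B ≠ ∞) :
    Integrable (Function.uncurry Kker) ((volume.restrict A).prod (volume.restrict B)) := by
  obtain ⟨M, hM⟩ := exists_lintegral_enorm_stripProfile_le
  have hmeas : Measurable (Function.uncurry Kker) := measurable_Kker
  refine ⟨hmeas.aestronglyMeasurable, ?_⟩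
  rw [hasFiniteIntegral_iff_enorm, lintegral_prod _ hmeas.enorm.aemeasurable]
  refine (lintegral_mono fun z => setLIntegral_enorm_Kker_le hM z B).trans_lt ?_
  rw [setLIntegral_const]
  exact ENNReal.mul_lt_top (by finiteness) hA.lt_top

lemma integrableOn_Kker (z : Strip) {A : Set Strip} (hA : volume A ≠ ∞) :
    IntegrableOn (Kker z) A := by
  obtain ⟨M, hM⟩ := exists_lintegral_enorm_stripProfile_le
  refine ⟨(measurable_Kker.comp measurable_prodMk_left).aestronglyMeasurable, ?_⟩
  rw [hasFiniteIntegral_iff_enorm]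
  exact (setLIntegral_enorm_Kker_le hM z A).trans_lt (by finiteness)

lemma volume_prod_univ_ne_top {T : Set ℝ} (hT : volume T ≠ ∞) :
    volume (T ×ˢ (Set.univ : Set Torus)) ≠ ∞ := by
  rw [Measure.volume_eq_prod, Measure.prod_prod]
  finiteness

lemma setIntegral_Kker_prod_univ (z : Strip) {T : Set ℝ} (hT : volume T ≠ ∞) :
    ∫ ξ in T ×ˢ (Set.univ : Set Torus), Kker z ξ = 0 := by
  have hint := integrableOn_Kker z (volume_prod_univ_ne_top hT)
  rw [Measure.volume_eq_prod] at hint ⊢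
  rw [setIntegral_prod _ hint]
  refine integral_eq_zero_of_ae (ae_restrict_of_ae ?_)
  filter_upwards [Measure.ae_ne volume z.1] with x hx
  simp only [Kker_eq_stripProfile, Measure.restrict_univ]
  rw [integral_sub_left_eq_self fun t => stripProfile (z.1 - x) t]
  exact integral_stripProfile (sub_ne_zero.mpr hx.symm)

lemma enorm_setIntegral_sub_setIntegral_le {α : Type*} [MeasurableSpace α] {μ : Measure α}
    {f : α → ℝ} {A B : Set α} (hA : MeasurableSet A) (hB : MeasurableSet B)
    (hfA : IntegrableOn f A μ) (hfB : IntegrableOn f B μ) :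
    ‖(∫ x in A, f x ∂μ) - ∫ x in B, f x ∂μ‖ₑ ≤ ∫⁻ x in symmDiff A B, ‖f x‖ₑ ∂μ := by
  rw [← integral_indicator hA, ← integral_indicator hB,
    ← integral_sub (hfA.integrable_indicator hA) (hfB.integrable_indicator hB),
    ← lintegral_indicator (hA.symmDiff hB)]
  refine (enorm_integral_le_lintegral_enorm _).trans (lintegral_mono fun x => ?_)
  by_cases h1 : x ∈ A <;> by_cases h2 : x ∈ B <;> simp [h1, h2, Set.mem_symmDiff]

/-- A symmetric kernel integrated over a square is at most twice its integral over the part where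
the second variable has the smaller weight. -/
lemma lintegral_lintegral_le_two_mul_of_symm {α : Type*} [MeasurableSpace α] {μ : Measure α}
    [SFinite μ] {k : α → α → ℝ≥0∞} (hk : Measurable (Function.uncurry k))
    (hsymm : ∀ x y, k x y = k y x) {d : α → ℝ} (hd : Measurable d) :
    ∫⁻ x, ∫⁻ y, k x y ∂μ ∂μ ≤ 2 * ∫⁻ x, ∫⁻ y in {y | d y ≤ d x}, k x y ∂μ ∂μ := by
  set q : α → α → ℝ≥0∞ := fun x y => {y | d y ≤ d x}.indicator (k x) y
  have hq : Measurable (Function.uncurry q) :=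
    hk.indicator (measurableSet_le (hd.comp measurable_snd) (hd.comp measurable_fst))
  have hq' : Measurable fun x => ∫⁻ y, q x y ∂μ := hq.lintegral_prod_right'
  have hle : ∀ x y, k x y ≤ q x y + q y x := by
    intro x y
    rcases le_total (d y) (d x) with h | h
    · simp [q, h]
    · simp [q, h, hsymm y x]
  calc ∫⁻ x, ∫⁻ y, k x y ∂μ ∂μ
      ≤ ∫⁻ x, ∫⁻ y, (q x y + q y x) ∂μ ∂μ := lintegral_mono fun x => lintegral_mono (hle x)
    _ = ∫⁻ x, ((∫⁻ y, q x y ∂μ) + ∫⁻ y, q y x ∂μ) ∂μ := by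
        refine lintegral_congr fun x => lintegral_add_left ?_ _
        exact hq.comp measurable_prodMk_left
    _ = (∫⁻ x, ∫⁻ y, q x y ∂μ ∂μ) + ∫⁻ x, ∫⁻ y, q y x ∂μ ∂μ := lintegral_add_left hq' _
    _ = 2 * ∫⁻ x, ∫⁻ y, q x y ∂μ ∂μ := by
        rw [lintegral_lintegral_swap (f := fun x y => q y x)
          (hq.comp measurable_swap).aemeasurable, two_mul]
    _ = _ := by
        congr 1
        refine lintegral_congr fun x => lintegral_indicator ?_ _
        exact measurableSet_le hd measurable_const

lemma volume_abs_abs_sub_le (L c : ℝ) :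
    volume {x : ℝ | |(|x| - L)| ≤ c} ≤ 4 * ENNReal.ofReal c := by
  have hsub : {x : ℝ | |(|x| - L)| ≤ c} ⊆
      Set.Icc (L - c) (L + c) ∪ Set.Icc (-L - c) (-L + c) := by
    intro x hx
    obtain ⟨h1, h2⟩ := abs_le.mp (show |(|x| - L)| ≤ c from hx)
    rcases abs_cases x with ⟨h, _⟩ | ⟨h, _⟩ <;> rw [h] at h1 h2
    · exact Or.inl ⟨by linarith, by linarith⟩
    · exact Or.inr ⟨by linarith, by linarith⟩
  refine (measure_mono hsub).trans ((measure_union_le _ _).trans_eq ?_)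
  rw [Real.volume_Icc, Real.volume_Icc, show L + c - (L - c) = 2 * c by ring,
    show -L + c - (-L - c) = 2 * c by ring, ENNReal.ofReal_mul zero_le_two, ENNReal.ofReal_ofNat]
  ring

lemma lintegral_lintegral_enorm_Kker_le {M : ℝ≥0}
    (hM : ∀ x : ℝ, ∫⁻ t : Torus, ‖stripProfile x t‖ₑ ≤ M) (L : ℝ) (D : Set Strip) :
    ∫⁻ z in D, ∫⁻ ξ in D, ‖Kker z ξ‖ₑ ≤
      8 * M * ∫⁻ z in D, ENNReal.ofReal |(|z.1| - L)| := by
  have hd : Measurable fun z : Strip => |(|z.1| - L)| := by fun_prop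
  refine (lintegral_lintegral_le_two_mul_of_symm measurable_Kker.enorm
    (fun z ξ => by rw [Kker_comm]) hd).trans ?_
  rw [show (8 : ℝ≥0∞) * M = 2 * (M * 4) by ring, mul_assoc,
    ← lintegral_const_mul _ hd.ennreal_ofReal]
  gcongr with z
  calc ∫⁻ ξ in {ξ : Strip | |(|ξ.1| - L)| ≤ |(|z.1| - L)|}, ‖Kker z ξ‖ₑ ∂volume.restrict D
      ≤ ∫⁻ ξ in {x : ℝ | |(|x| - L)| ≤ |(|z.1| - L)|} ×ˢ (Set.univ : Set Torus), ‖Kker z ξ‖ₑ := by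
        refine lintegral_mono' (Measure.restrict_mono' ?_ Measure.restrict_le_self) le_rfl
        exact Filter.Eventually.of_forall fun ξ hξ => ⟨hξ, trivial⟩
    _ ≤ M * (4 * ENNReal.ofReal |(|z.1| - L)|) :=
        (lintegral_enorm_Kker_prod_univ_le hM z _).trans (by
          gcongr
          exact volume_abs_abs_sub_le L _)
    _ = _ := by ring

/-- There exist `C > 0` and `L₀ > 2` such that for every `L > L₀` and every
measurable `E ⊆ S` of measure `4πL` centered around the origin,
`|∫_E∫_E K - ∫_{E₀}∫_{E₀} K| ≤ C ∫_{E Δ E₀} ||x|-L| dz` where `E₀ = [-L,L] × 𝕋`. -/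
theorem stmt_5 :
    ∃ C > (0 : ℝ), ∃ L₀ > (2 : ℝ), ∀ L > L₀, ∀ E : Set Strip, MeasurableSet E →
      volume E = ENNReal.ofReal (4 * π * L) →
      volume (E ∩ {z : Strip | 0 < z.1}) = volume E / 2 →
      volume (E ∩ {z : Strip | z.1 < 0}) = volume E / 2 →
      ENNReal.ofReal
          |(∫ z in E, ∫ ξ in E, Kker z ξ) -
            ∫ z in (Set.Icc (-L) L ×ˢ (Set.univ : Set Torus)),
              ∫ ξ in (Set.Icc (-L) L ×ˢ (Set.univ : Set Torus)), Kker z ξ| ≤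
        ENNReal.ofReal C *
          ∫⁻ z in symmDiff E (Set.Icc (-L) L ×ˢ (Set.univ : Set Torus)),
            ENNReal.ofReal |(|z.1| - L)| := by
  obtain ⟨M, hM⟩ := exists_lintegral_enorm_stripProfile_le
  refine ⟨8 * M + 1, by positivity, 3, by norm_num, fun L _ E hE hvol _ _ => ?_⟩
  set E₀ : Set Strip := Set.Icc (-L) L ×ˢ (Set.univ : Set Torus)
  have hE₀ : MeasurableSet E₀ := measurableSet_Icc.prod .univ
  have hIcc : volume (Set.Icc (-L) L) ≠ ∞ := by simp
  have hfin : volume E ≠ ∞ := by rw [hvol]; finiteness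
  have hfin₀ : volume E₀ ≠ ∞ := volume_prod_univ_ne_top hIcc
  have hzero (z : Strip) : ∫ ξ in E₀, Kker z ξ = 0 := setIntegral_Kker_prod_univ z hIcc
  have hswap : ∫ z in E₀, ∫ ξ in E, Kker z ξ = 0 := by
    rw [integral_integral_swap (integrable_Kker_prod hfin₀ hfin)]
    simp_rw [fun z ξ => Kker_comm z ξ]
    simp [hzero]
  simp only [hzero, integral_zero, sub_zero]
  rw [← Real.enorm_eq_ofReal_abs, ← sub_zero (∫ z in E, ∫ ξ in E, Kker z ξ), ← hswap]
  calc ‖(∫ z in E, ∫ ξ in E, Kker z ξ) - ∫ z in E₀, ∫ ξ in E, Kker z ξ‖ₑ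
      ≤ ∫⁻ z in symmDiff E E₀, ‖∫ ξ in E, Kker z ξ‖ₑ :=
        enorm_setIntegral_sub_setIntegral_le hE hE₀
          (integrable_Kker_prod hfin hfin).integral_prod_left
          (integrable_Kker_prod hfin₀ hfin).integral_prod_left
    _ ≤ ∫⁻ z in symmDiff E E₀, ∫⁻ ξ in symmDiff E E₀, ‖Kker z ξ‖ₑ := by
        refine lintegral_mono fun z => ?_
        rw [← sub_zero (∫ ξ in E, Kker z ξ), ← hzero z]
        exact enorm_setIntegral_sub_setIntegral_le hE hE₀ (integrableOn_Kker z hfin)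
          (integrableOn_Kker z hfin₀)
    _ ≤ 8 * M * ∫⁻ z in symmDiff E E₀, ENNReal.ofReal |(|z.1| - L)| :=
        lintegral_lintegral_enorm_Kker_le hM L _
    _ ≤ _ := by
        gcongr
        rw [ENNReal.le_ofReal_iff_toReal_le (by finiteness) (by positivity)]
        simp
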